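/- arXiv:2105.01268 — 2 statements merged into one kernel-verified Lean document; each statement's English description precedes it below -/
import Mathlib

section
/- Let K be a commutative monoid and α = (D_x, α_x) a unital partial action of a group G on K, with D_x = K·1_x for central idempotents 1_x. Then the coboundary maps δⁿ : Cⁿ(G,α,K) → Cⁿ⁺¹(G,α,K) are group homomorphisms satisfying (δⁿ⁺¹ ∘ δⁿ)(f)(x₁,…,x_{n+2}) = 1_{x₁} 1_{x₁x₂} ⋯ 1_{x₁⋯x_{n+2}} for every n-cochain f, i.e., δⁿ⁺¹ ∘ δⁿ is the identity element of the cochain group. -/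
noncomputable section

/-- The ordered partial product `x₁ x₂ ⋯ x_{i+1}` of the first entries of a tuple in a
group `G`. -/
def partialProd {G : Type*} [Group G] {n : ℕ} (x : Fin n → G) (i : Fin n) : G :=
  (List.ofFn (fun j : Fin (i.1 + 1) => x (Fin.castLE i.isLt j))).prod

/-- The idempotent `1_{x₁} 1_{x₁x₂} ⋯ 1_{x₁⋯xₙ}` attached to an `n`-tuple, for a family
`e : G → K` of idempotents. -/
def bigE {G K : Type*} [Group G] [CommMonoid K] (e : G → K) {n : ℕ} (x : Fin n → G) : K :=
  ∏ i : Fin n, e (partialProd x i)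

/-- An `n`-cochain of `G` with values in `K` relative to the unital partial action with
idempotents `e`: a function `f : Gⁿ → K` such that each value `f x` is an invertible
element of the ideal `K · (1_{x₁} 1_{x₁x₂} ⋯ 1_{x₁⋯xₙ})`. -/
def IsPCochain {G K : Type*} [Group G] [CommMonoid K] (e : G → K) {n : ℕ}
    (f : (Fin n → G) → K) : Prop :=
  ∀ x : Fin n → G, f x * bigE e x = f x ∧ ∃ t : K, t * bigE e x = t ∧ f x * t = bigE e x

open Classical in
/-- The inverse of `k` taken in the ideal `K·w` (`w` an idempotent); it is unique when it
exists. -/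
def iInv {K : Type*} [CommMonoid K] (k w : K) : K :=
  if h : ∃ t : K, t * w = t ∧ k * t = w then h.choose else w

/-- The `i`-th "face" of an `(n+1)`-tuple: multiply the `i`-th and `(i+1)`-st entries. -/
def dface {G : Type*} [Group G] {n : ℕ} (x : Fin (n + 1) → G) (i : Fin n) : Fin n → G :=
  fun j =>
    if j.1 < i.1 then x (Fin.castSucc j)
    else if j = i then x (Fin.castSucc i) * x i.succ
    else x j.succ

/-- The partial coboundary map
`(δⁿf)(x₁,…,x_{n+1}) = α_{x₁}(f(x₂,…,x_{n+1}) 1_{x₁⁻¹}) ·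
∏_{i=1}^{n} f(x₁,…,x_i x_{i+1},…,x_{n+1})^{(-1)^i} · f(x₁,…,xₙ)^{(-1)^{n+1}}`,
all inverses being taken in the corresponding ideals. -/
def pδ {G K : Type*} [Group G] [CommMonoid K] (e : G → K) (α : G → K → K) {n : ℕ}
    (f : (Fin n → G) → K) : (Fin (n + 1) → G) → K := fun x =>
  α (x 0) (f (Fin.tail x) * e (x 0)⁻¹) *
  (∏ i : Fin n,
      if Even (i.1 + 1) then f (dface x i)
      else iInv (f (dface x i)) (bigE e (dface x i))) *
  (if Even (n + 1) then f (Fin.init x) else iInv (f (Fin.init x)) (bigE e (Fin.init x)))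

section SequenceModel

open Finset

variable {G K : Type*} [Group G] [CommMonoid K]

/-- The laws of a unital partial action with idempotents `e`, where the partial isomorphism
`α x` is only evaluated on the ideal `K · e x⁻¹`. -/
structure IsUnitalPartialAction (e : G → K) (α : G → K → K) : Prop where
  idem : ∀ x, e x * e x = e x
  mem : ∀ (x : G) (k : K), α x (k * e x⁻¹) * e x = α x (k * e x⁻¹)
  map_mul : ∀ (x : G) (a b : K),
    α x ((a * e x⁻¹) * (b * e x⁻¹)) = α x (a * e x⁻¹) * α x (b * e x⁻¹)
  inv : ∀ (x : G) (k : K), α x⁻¹ (α x (k * e x⁻¹) * e x) = k * e x⁻¹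
  comp : ∀ (x y : G) (k : K),
    α x (α y (k * e y⁻¹) * e x⁻¹) = α (x * y) (k * e (x * y)⁻¹) * e x

/-- The product of the first `k` terms of a sequence. -/
def prefixProd (x : ℕ → G) : ℕ → G
  | 0 => 1
  | k + 1 => prefixProd x k * x k

/-- The `i`-th face of a sequence: drop the first term if `i = 0`, and otherwise multiply the
`i`-th and `(i+1)`-st terms (counted from one). -/
def mergeAt (i : ℕ) (x : ℕ → G) : ℕ → G := fun j =>
  if j + 1 < i then x j else if j + 1 = i then x j * x (j + 1) else x (j + 1)

/-- The idempotent attached to the first `n` terms of a sequence. -/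
def idemProd (e : G → K) (n : ℕ) (x : ℕ → G) : K :=
  ∏ k ∈ range n, e (prefixProd x (k + 1))

/-- The `i`-th factor of the coboundary, without its sign. -/
def faceTerm (e : G → K) (α : G → K → K) (i : ℕ) (F : (ℕ → G) → K) (x : ℕ → G) : K :=
  if i = 0 then α (x 0) (F (mergeAt 0 x) * e (x 0)⁻¹) else F (mergeAt i x)

/-- The power `a ^ (-1) ^ i`, where `b` plays the role of the inverse of `a`. -/
def altPow {M : Type*} (i : ℕ) (a b : M) : M := if Even i then a else b

/-- The partial coboundary of a function `F` on sequences, where `F'` is the inverse of `F`. -/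
def seqCoboundary (e : G → K) (α : G → K → K) (n : ℕ) (F F' : (ℕ → G) → K) (x : ℕ → G) : K :=
  ∏ i ∈ range (n + 2), faceTerm e α i (altPow i F F') x

lemma mergeAt_mergeAt {i j : ℕ} (hij : i ≤ j) (x : ℕ → G) :
    mergeAt j (mergeAt i x) = mergeAt i (mergeAt (j + 1) x) := by
  funext k
  simp only [mergeAt]
  split_ifs <;> first | rfl | omega | (simp only [mul_assoc])

lemma prefixProd_mergeAt {i : ℕ} (hi : 1 ≤ i) (x : ℕ → G) (k : ℕ) :
    prefixProd (mergeAt i x) k = prefixProd x (if k < i then k else k + 1) := by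
  induction k with
  | zero => rw [if_pos (by omega)]; rfl
  | succ k ih =>
    rw [prefixProd, ih, mergeAt]
    rcases lt_trichotomy (k + 1) i with h | h | h
    · rw [if_pos (by omega), if_pos h, if_pos h, prefixProd]
    · rw [if_pos (by omega), if_neg (by omega), if_pos h, if_neg (by omega), prefixProd,
        prefixProd, mul_assoc]
    · rw [if_neg (by omega), if_neg (by omega), if_neg (by omega), if_neg (by omega),
        prefixProd, prefixProd]
      rfl

lemma mul_prefixProd_mergeAt_zero (x : ℕ → G) (k : ℕ) :
    x 0 * prefixProd (mergeAt 0 x) k = prefixProd x (k + 1) := by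
  induction k with
  | zero => simp [prefixProd]
  | succ k ih =>
    rw [prefixProd, ← mul_assoc, ih]
    simp [prefixProd, mergeAt]

lemma prod_mul_eq_right {ι M : Type*} [CommMonoid M] {w : M} {s : Finset ι} {f : ι → M}
    (h : ∀ i ∈ s, f i * w = w) : (∏ i ∈ s, f i) * w = w := by
  classical
  induction s using Finset.induction_on with
  | empty => simp
  | insert a s ha ih =>
    rw [prod_insert ha, mul_assoc, ih fun i hi => h i (mem_insert_of_mem hi),
      h a (mem_insert_self a s)]

lemma prod_range_prod_range_mul_eq_right {M : Type*} [CommMonoid M] {w : M} (T : ℕ → ℕ → M)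
    (n : ℕ) (h : ∀ i j, i ≤ j → j < n → T i j * T (j + 1) i * w = w) :
    (∏ i ∈ range (n + 1), ∏ j ∈ range n, T i j) * w = w := by
  induction n with
  | zero => simp
  | succ n ih =>
    have hsplit : ∏ i ∈ range (n + 1 + 1), ∏ j ∈ range (n + 1), T i j =
        (∏ i ∈ range (n + 1), ∏ j ∈ range n, T i j) *
          ∏ i ∈ range (n + 1), T i n * T (n + 1) i := by
      rw [prod_range_succ, prod_congr rfl fun i _ => prod_range_succ (T i) n,
        prod_mul_distrib, prod_mul_distrib, mul_assoc]
    have hlast : (∏ i ∈ range (n + 1), T i n * T (n + 1) i) * w = w :=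
      prod_mul_eq_right fun i hi =>
        h i n (Nat.le_of_lt_succ (mem_range.1 hi)) n.lt_succ_self
    rw [hsplit, mul_assoc, hlast, ih fun i j hij hj => h i j hij (by omega)]

variable {e : G → K} {α : G → K → K}

lemma faceTerm_zero (F : (ℕ → G) → K) (x : ℕ → G) :
    faceTerm e α 0 F x = α (x 0) (F (mergeAt 0 x) * e (x 0)⁻¹) := if_pos rfl

lemma faceTerm_of_ne_zero {i : ℕ} (hi : i ≠ 0) (F : (ℕ → G) → K) (x : ℕ → G) :
    faceTerm e α i F x = F (mergeAt i x) := if_neg hi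

lemma altPow_seqCoboundary (i n : ℕ) (F F' : (ℕ → G) → K) :
    altPow i (seqCoboundary e α n F F') (seqCoboundary e α n F' F) =
      seqCoboundary e α n (altPow i F F') (altPow i F' F) := by
  unfold altPow
  split_ifs <;> rfl

/-- `F` is invertible modulo the idempotents of level `n`, with inverse `F'`. -/
def IsInvMod (e : G → K) (n : ℕ) (F F' : (ℕ → G) → K) : Prop :=
  ∀ x, F x * F' x * idemProd e n x = idemProd e n x

lemma IsInvMod.symm {n : ℕ} {F F' : (ℕ → G) → K} (h : IsInvMod e n F F') :
    IsInvMod e n F' F := fun x => by rw [mul_comm (F' x), h x]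

lemma IsInvMod.altPow {n : ℕ} {F F' : (ℕ → G) → K} (h : IsInvMod e n F F') (i : ℕ) :
    IsInvMod e n (altPow i F F') (altPow i F' F) := by
  unfold _root_.altPow
  split_ifs
  exacts [h, h.symm]

lemma IsInvMod.altPow_altPow {n : ℕ} {F F' : (ℕ → G) → K} (h : IsInvMod e n F F')
    (i j : ℕ) :
    IsInvMod e n (_root_.altPow j (_root_.altPow i F F') (_root_.altPow i F' F))
      (_root_.altPow i (_root_.altPow (j + 1) F F') (_root_.altPow (j + 1) F' F)) := by
  by_cases hi : Even i <;> by_cases hj : Even j <;>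
    simp only [_root_.altPow, hi, hj, Nat.even_add_one, not_true_eq_false,
      not_false_eq_true, if_true, if_false] <;>
    first | exact h | exact h.symm

/-- `F` takes invertible values in the ideals generated by the idempotents of level `n`, and
`F'` is its inverse there. -/
structure IsInvPair (e : G → K) (n : ℕ) (F F' : (ℕ → G) → K) : Prop where
  left_mul : ∀ x, F x * idemProd e n x = F x
  mul_eq : ∀ x, F x * F' x = idemProd e n x

namespace IsUnitalPartialAction

lemma act_mul (h : IsUnitalPartialAction e α) (g : G) (a b : K) :
    α g (a * b * e g⁻¹) = α g (a * e g⁻¹) * α g (b * e g⁻¹) := by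
  rw [← h.map_mul, mul_mul_mul_comm, h.idem]

lemma act_idem (h : IsUnitalPartialAction e α) (g : G) : α g (e g⁻¹) = e g := by
  have hinv : α g (α g⁻¹ (e g) * e g⁻¹) = e g := by
    have := h.inv g⁻¹ 1
    simpa using this
  have hmem : α g (e g⁻¹) * e g = α g (e g⁻¹) := by simpa using h.mem g 1
  calc α g (e g⁻¹) = α g (e g⁻¹) * α g (α g⁻¹ (e g) * e g⁻¹) := by rw [hinv, hmem]
    _ = α g (1 * e g⁻¹) * α g (α g⁻¹ (e g) * e g⁻¹) := by rw [one_mul]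
    _ = e g := by rw [← h.act_mul, one_mul, hinv]

lemma act_idem_mul (h : IsUnitalPartialAction e α) (g k : G) :
    α g (e k * e g⁻¹) = e (g * k) * e g := by
  have := h.comp g k 1
  rwa [one_mul, one_mul, h.act_idem, h.act_idem] at this

lemma idemProd_mul (h : IsUnitalPartialAction e α) (n : ℕ) (x : ℕ → G) :
    idemProd e n x * idemProd e n x = idemProd e n x := by
  rw [idemProd, ← prod_mul_distrib]
  exact prod_congr rfl fun k _ => h.idem _

lemma idemProd_mul_of_lt (h : IsUnitalPartialAction e α) {n k : ℕ} (hk : k < n)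
    (x : ℕ → G) : idemProd e n x * e (prefixProd x (k + 1)) = idemProd e n x := by
  rw [idemProd, ← prod_erase_mul _ _ (mem_range.2 hk), mul_assoc, h.idem]

lemma act_idemProd (h : IsUnitalPartialAction e α) (n : ℕ) (x : ℕ → G) :
    α (x 0) (idemProd e n (mergeAt 0 x) * e (x 0)⁻¹) = idemProd e (n + 1) x := by
  induction n with
  | zero => simp [idemProd, prefixProd, h.act_idem]
  | succ n ih =>
    have h0 := h.idemProd_mul_of_lt (Nat.succ_pos n) x
    rw [zero_add, prefixProd, prefixProd, one_mul] at h0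
    rw [idemProd, prod_range_succ, h.act_mul, ← idemProd, ih, h.act_idem_mul,
      mul_prefixProd_mergeAt_zero, mul_left_comm, h0, mul_comm]
    exact (prod_range_succ _ _).symm

end IsUnitalPartialAction

lemma idemProd_mergeAt_of_lt {n i : ℕ} (hn : n < i) (x : ℕ → G) :
    idemProd e n (mergeAt i x) = idemProd e n x := by
  refine prod_congr rfl fun k hk => ?_
  have := mem_range.1 hk
  rw [prefixProd_mergeAt (by omega), if_pos (by omega)]

lemma idemProd_mergeAt_mul (i d : ℕ) (x : ℕ → G) :
    idemProd e (i + d) (mergeAt (i + 1) x) * e (prefixProd x (i + 1)) =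
      idemProd e (i + d + 1) x := by
  induction d with
  | zero =>
    rw [idemProd_mergeAt_of_lt (by omega)]
    exact (prod_range_succ _ _).symm
  | succ d ih =>
    rw [← add_assoc, idemProd, prod_range_succ, ← idemProd, mul_right_comm, ih,
      prefixProd_mergeAt (by omega), if_neg (by omega)]
    exact (prod_range_succ _ _).symm

namespace IsUnitalPartialAction

lemma faceTerm_mul (h : IsUnitalPartialAction e α) (i : ℕ) (F F' : (ℕ → G) → K)
    (x : ℕ → G) :
    faceTerm e α i (fun y => F y * F' y) x = faceTerm e α i F x * faceTerm e α i F' x := by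
  unfold faceTerm
  split_ifs
  exacts [h.act_mul _ _ _, rfl]

lemma faceTerm_prod (h : IsUnitalPartialAction e α) (i m : ℕ) (F : ℕ → (ℕ → G) → K)
    (x : ℕ → G) :
    faceTerm e α i (fun y => ∏ j ∈ range (m + 1), F j y) x =
      ∏ j ∈ range (m + 1), faceTerm e α i (F j) x := by
  induction m with
  | zero => simp
  | succ m ih =>
    rw [prod_range_succ, ← ih, ← h.faceTerm_mul]
    simp only [prod_range_succ _ (m + 1)]

lemma isInvMod_faceTerm (h : IsUnitalPartialAction e α) {n i : ℕ} (hi : i ≤ n + 1)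
    {F F' : (ℕ → G) → K} (hF : IsInvMod e n F F') :
    IsInvMod e (n + 1) (faceTerm e α i F) (faceTerm e α i F') := by
  intro x
  obtain _ | i := i
  · rw [faceTerm_zero, faceTerm_zero, ← h.act_idemProd, ← h.act_mul, ← h.act_mul, hF]
  · obtain ⟨d, rfl⟩ := Nat.exists_eq_add_of_le (Nat.le_of_succ_le_succ hi)
    rw [faceTerm_of_ne_zero (by omega), faceTerm_of_ne_zero (by omega),
      ← idemProd_mergeAt_mul, ← mul_assoc, hF]

lemma faceTerm_faceTerm (h : IsUnitalPartialAction e α) {n i j : ℕ} (hij : i ≤ j)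
    (F : (ℕ → G) → K) (x : ℕ → G) :
    faceTerm e α i (faceTerm e α j F) x * idemProd e (n + 1) x =
      faceTerm e α (j + 1) (faceTerm e α i F) x * idemProd e (n + 1) x := by
  obtain _ | i := i
  · obtain _ | j := j
    · have h0 := h.idemProd_mul_of_lt (Nat.succ_pos n) x
      rw [zero_add, prefixProd, prefixProd, one_mul] at h0
      rw [faceTerm_zero, faceTerm_zero, faceTerm_of_ne_zero (by omega), faceTerm_zero,
        h.comp, mergeAt_mergeAt le_rfl, mul_assoc, mul_comm (e _), zero_add]
      simp [mergeAt, h0]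
    · rw [faceTerm_zero, faceTerm_of_ne_zero (by omega), faceTerm_of_ne_zero (by omega),
        faceTerm_zero, mergeAt_mergeAt (by omega)]
      simp [mergeAt]
  · rw [faceTerm_of_ne_zero (by omega), faceTerm_of_ne_zero (by omega),
      faceTerm_of_ne_zero (by omega), faceTerm_of_ne_zero (by omega),
      mergeAt_mergeAt hij]

lemma seqCoboundary_mul_idemProd (h : IsUnitalPartialAction e α) {n : ℕ}
    {F F' : (ℕ → G) → K} (hF : ∀ x, F x * idemProd e n x = F x) (x : ℕ → G) :
    seqCoboundary e α n F F' x * idemProd e (n + 1) x = seqCoboundary e α n F F' x := by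
  have h0 : faceTerm e α 0 F x * idemProd e (n + 1) x = faceTerm e α 0 F x := by
    rw [faceTerm_zero, ← h.act_idemProd, ← h.act_mul, hF]
  rw [seqCoboundary, prod_range_succ', mul_assoc]
  congr 1

lemma isInvPair_seqCoboundary (h : IsUnitalPartialAction e α) {n : ℕ}
    {F F' : (ℕ → G) → K} (hF : IsInvPair e n F F') :
    IsInvPair e (n + 1) (seqCoboundary e α n F F') (seqCoboundary e α n F' F) where
  left_mul := h.seqCoboundary_mul_idemProd hF.left_mul
  mul_eq x := by
    have hmod : IsInvMod e n F F' := fun y => by rw [hF.mul_eq, h.idemProd_mul]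
    rw [← h.seqCoboundary_mul_idemProd hF.left_mul, mul_right_comm, seqCoboundary,
      seqCoboundary, ← prod_mul_distrib]
    exact prod_mul_eq_right fun i hi =>
      h.isInvMod_faceTerm (by have := mem_range.1 hi; omega) (hmod.altPow i) x

lemma seqCoboundary_mul (h : IsUnitalPartialAction e α) (n : ℕ) (F F' H H' : (ℕ → G) → K)
    (x : ℕ → G) :
    seqCoboundary e α n (fun y => F y * H y) (fun y => F' y * H' y) x =
      seqCoboundary e α n F F' x * seqCoboundary e α n H H' x := by
  rw [seqCoboundary, seqCoboundary, seqCoboundary, ← prod_mul_distrib]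
  refine prod_congr rfl fun i _ => ?_
  rw [← h.faceTerm_mul]
  unfold altPow
  split_ifs <;> rfl

lemma seqCoboundary_seqCoboundary (h : IsUnitalPartialAction e α) {n : ℕ}
    {F F' : (ℕ → G) → K} (hF : IsInvPair e n F F') (x : ℕ → G) :
    seqCoboundary e α (n + 1) (seqCoboundary e α n F F') (seqCoboundary e α n F' F) x =
      idemProd e (n + 2) x := by
  have hmod : IsInvMod e n F F' := fun y => by rw [hF.mul_eq, h.idemProd_mul]
  rw [← h.seqCoboundary_mul_idemProd (h.isInvPair_seqCoboundary hF).left_mul]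
  have hexpand : seqCoboundary e α (n + 1) (seqCoboundary e α n F F')
      (seqCoboundary e α n F' F) x = ∏ i ∈ range (n + 2 + 1), ∏ j ∈ range (n + 2),
        faceTerm e α i (faceTerm e α j (altPow j (altPow i F F') (altPow i F' F))) x := by
    rw [seqCoboundary]
    refine prod_congr rfl fun i _ => ?_
    rw [altPow_seqCoboundary]
    exact h.faceTerm_prod i (n + 1) _ x
  rw [hexpand]
  refine prod_range_prod_range_mul_eq_right _ _ fun i j hij hj => ?_
  rw [mul_right_comm, h.faceTerm_faceTerm hij, mul_right_comm]
  exact h.isInvMod_faceTerm (by omega)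
    (h.isInvMod_faceTerm (by omega) (hmod.altPow_altPow i j)) x

end IsUnitalPartialAction

/-- The tuple of the first `n` terms of a sequence. -/
def truncate (n : ℕ) (x : ℕ → G) : Fin n → G := fun i => x i

lemma exists_truncate_eq {n : ℕ} (x : Fin n → G) : ∃ y : ℕ → G, truncate n y = x :=
  ⟨fun i => if hi : i < n then x ⟨i, hi⟩ else 1, by funext i; simp [truncate]⟩

lemma prod_ofFn_eq_prefixProd (x : ℕ → G) (n : ℕ) :
    (List.ofFn fun j : Fin n => x j).prod = prefixProd x n := by
  induction n with
  | zero => simp [prefixProd]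
  | succ n ih =>
    rw [List.ofFn_succ_last, List.prod_append, List.prod_singleton, prefixProd, ← ih]
    rfl

lemma bigE_truncate (n : ℕ) (x : ℕ → G) : bigE e (truncate n x) = idemProd e n x := by
  rw [bigE, idemProd, prod_range]
  exact prod_congr rfl fun i _ => congrArg e (prod_ofFn_eq_prefixProd x (i + 1))

lemma tail_truncate (n : ℕ) (x : ℕ → G) :
    Fin.tail (truncate (n + 1) x) = truncate n (mergeAt 0 x) := by
  funext i
  simp [Fin.tail, truncate, mergeAt]

lemma init_truncate (n : ℕ) (x : ℕ → G) :
    Fin.init (truncate (n + 1) x) = truncate n (mergeAt (n + 1) x) := by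
  funext i
  simp [Fin.init, truncate, mergeAt]

lemma dface_truncate (n : ℕ) (x : ℕ → G) (i : Fin n) :
    dface (truncate (n + 1) x) i = truncate n (mergeAt (i + 1) x) := by
  funext j
  simp only [dface, truncate, mergeAt, Fin.ext_iff, Nat.add_lt_add_iff_right,
    Nat.add_right_cancel_iff, Fin.val_castSucc, Fin.val_succ]
  split_ifs with h1 h2
  · rfl
  · rw [h2]
  · rfl

lemma iInv_eq {k t w : K} (htw : t * w = t) (hkt : k * t = w) : iInv k w = t := by
  have hex : ∃ t : K, t * w = t ∧ k * t = w := ⟨t, htw, hkt⟩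
  rw [iInv, dif_pos hex]
  obtain ⟨h1, h2⟩ := hex.choose_spec
  calc hex.choose = hex.choose * (k * t) := by rw [hkt, h1]
    _ = t * (k * hex.choose) := by ac_rfl
    _ = t := by rw [h2, htw]

/-- `f` and `f'` are mutually inverse cochains. -/
structure IsCochainPair (e : G → K) {n : ℕ} (f f' : (Fin n → G) → K) : Prop where
  left_mul : ∀ x, f x * bigE e x = f x
  right_mul : ∀ x, f' x * bigE e x = f' x
  mul_eq : ∀ x, f x * f' x = bigE e x

namespace IsCochainPair

variable {n : ℕ} {f f' g g' : (Fin n → G) → K}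

lemma symm (hf : IsCochainPair e f f') : IsCochainPair e f' f :=
  ⟨hf.right_mul, hf.left_mul, fun x => by rw [mul_comm, hf.mul_eq]⟩

lemma isPCochain (hf : IsCochainPair e f f') : IsPCochain e f :=
  fun x => ⟨hf.left_mul x, f' x, hf.right_mul x, hf.mul_eq x⟩

protected lemma mul (h : IsUnitalPartialAction e α) (hf : IsCochainPair e f f')
    (hg : IsCochainPair e g g') :
    IsCochainPair e (fun x => f x * g x) (fun x => f' x * g' x) where
  left_mul x := by rw [mul_assoc, hg.left_mul]
  right_mul x := by rw [mul_assoc, hg.right_mul]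
  mul_eq x := by
    obtain ⟨y, rfl⟩ := exists_truncate_eq x
    rw [mul_mul_mul_comm, hf.mul_eq, hg.mul_eq, bigE_truncate, h.idemProd_mul]

lemma isInvPair (hf : IsCochainPair e f f') :
    IsInvPair e n (f ∘ truncate n) (f' ∘ truncate n) where
  left_mul x := by rw [← bigE_truncate]; exact hf.left_mul _
  mul_eq x := by rw [← bigE_truncate]; exact hf.mul_eq _

lemma pδ_truncate (hf : IsCochainPair e f f') (α : G → K → K) (x : ℕ → G) :
    pδ e α f (truncate (n + 1) x) =
      seqCoboundary e α n (f ∘ truncate n) (f' ∘ truncate n) x := by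
  have hiInv : ∀ y, iInv (f y) (bigE e y) = f' y := fun y =>
    iInv_eq (hf.right_mul y) (hf.mul_eq y)
  have hterm : ∀ i, faceTerm e α (i + 1)
      (altPow (i + 1) (f ∘ truncate n) (f' ∘ truncate n)) x =
        if Even (i + 1) then f (truncate n (mergeAt (i + 1) x))
        else f' (truncate n (mergeAt (i + 1) x)) := by
    intro i
    rw [faceTerm_of_ne_zero (by omega)]
    unfold altPow
    split_ifs <;> rfl
  simp only [pδ, hiInv, tail_truncate, init_truncate, dface_truncate]
  rw [seqCoboundary, prod_range_succ, prod_range_succ', prod_range, hterm,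
    prod_congr rfl fun (i : Fin n) _ => hterm i, faceTerm_zero, mul_comm (α _ _)]
  rfl

lemma pδ_comp_truncate (hf : IsCochainPair e f f') (α : G → K → K) :
    pδ e α f ∘ truncate (n + 1) =
      seqCoboundary e α n (f ∘ truncate n) (f' ∘ truncate n) :=
  funext (hf.pδ_truncate α)

protected lemma pδ (h : IsUnitalPartialAction e α) (hf : IsCochainPair e f f') :
    IsCochainPair e (pδ e α f) (pδ e α f') where
  left_mul x := by
    obtain ⟨y, rfl⟩ := exists_truncate_eq x
    rw [hf.pδ_truncate, bigE_truncate, (h.isInvPair_seqCoboundary hf.isInvPair).left_mul]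
  right_mul x := by
    obtain ⟨y, rfl⟩ := exists_truncate_eq x
    rw [hf.symm.pδ_truncate, bigE_truncate,
      (h.isInvPair_seqCoboundary hf.symm.isInvPair).left_mul]
  mul_eq x := by
    obtain ⟨y, rfl⟩ := exists_truncate_eq x
    rw [hf.pδ_truncate, hf.symm.pδ_truncate, bigE_truncate,
      (h.isInvPair_seqCoboundary hf.isInvPair).mul_eq]

lemma pδ_mul (h : IsUnitalPartialAction e α) (hf : IsCochainPair e f f')
    (hg : IsCochainPair e g g') (x : Fin (n + 1) → G) :
    _root_.pδ e α (fun y => f y * g y) x = _root_.pδ e α f x * _root_.pδ e α g x := by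
  obtain ⟨y, rfl⟩ := exists_truncate_eq x
  rw [(hf.mul h hg).pδ_truncate, hf.pδ_truncate, hg.pδ_truncate]
  exact h.seqCoboundary_mul n _ _ _ _ y

lemma pδ_pδ (h : IsUnitalPartialAction e α) (hf : IsCochainPair e f f')
    (x : Fin (n + 2) → G) : _root_.pδ e α (_root_.pδ e α f) x = bigE e x := by
  obtain ⟨y, rfl⟩ := exists_truncate_eq x
  rw [(hf.pδ h).pδ_truncate, hf.pδ_comp_truncate, hf.symm.pδ_comp_truncate, bigE_truncate,
    h.seqCoboundary_seqCoboundary hf.isInvPair]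

end IsCochainPair

lemma IsPCochain.exists_isCochainPair {n : ℕ} {f : (Fin n → G) → K}
    (hf : IsPCochain e f) : ∃ f', IsCochainPair e f f' := by
  choose f' hf' using fun x => (hf x).2
  exact ⟨f', fun x => (hf x).1, fun x => (hf' x).1, fun x => (hf' x).2⟩

end SequenceModel

/-- for a unital partial action `α = (D_x, α_x)` of a group `G` on a
commutative monoid `K` (with `D_x = K·(e x)` for central idempotents `e x`), the
coboundary maps `δⁿ : Cⁿ(G,α,K) → Cⁿ⁺¹(G,α,K)` are group homomorphisms (they send
cochains to cochains multiplicatively) satisfying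
`(δⁿ⁺¹ ∘ δⁿ)(f)(x₁,…,x_{n+2}) = 1_{x₁} 1_{x₁x₂} ⋯ 1_{x₁⋯x_{n+2}}`, i.e. `δⁿ⁺¹ ∘ δⁿ` is
the identity element of the cochain group. -/
theorem statement11 {G K : Type*} [Group G] [CommMonoid K]
    (e : G → K) (α : G → K → K)
    (he : ∀ x, IsIdempotentElem (e x)) (he1 : e 1 = 1)
    (hα1 : ∀ k : K, α 1 k = k)
    (hmem : ∀ (x : G) (k : K), α x (k * e x⁻¹) * e x = α x (k * e x⁻¹))
    (hmul : ∀ (x : G) (a b : K),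
      α x ((a * e x⁻¹) * (b * e x⁻¹)) = α x (a * e x⁻¹) * α x (b * e x⁻¹))
    (hinv : ∀ (x : G) (k : K), α x⁻¹ (α x (k * e x⁻¹) * e x) = k * e x⁻¹)
    (hcomp : ∀ (x y : G) (k : K),
      α x (α y (k * e y⁻¹) * e x⁻¹) = α (x * y) (k * e (x * y)⁻¹) * e x) :
    (∀ (n : ℕ) (f : (Fin n → G) → K), IsPCochain e f → IsPCochain e (pδ e α f)) ∧
    (∀ (n : ℕ) (f g : (Fin n → G) → K), IsPCochain e f → IsPCochain e g →
      pδ e α (fun x => f x * g x) = fun x => pδ e α f x * pδ e α g x) ∧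
    (∀ (n : ℕ) (f : (Fin n → G) → K), IsPCochain e f →
      ∀ x : Fin (n + 2) → G, pδ e α (pδ e α f) x = bigE e x) := by
  have h : IsUnitalPartialAction e α := ⟨he, hmem, hmul, hinv, hcomp⟩
  refine ⟨fun n f hf => ?_, fun n f g hf hg => ?_, fun n f hf x => ?_⟩
  · obtain ⟨f', hf'⟩ := hf.exists_isCochainPair
    exact (hf'.pδ h).isPCochain
  · obtain ⟨f', hf'⟩ := hf.exists_isCochainPair
    obtain ⟨g', hg'⟩ := hg.exists_isCochainPair
    exact funext (hf'.pδ_mul h hg')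
  · obtain ⟨f', hf'⟩ := hf.exists_isCochainPair
    exact hf'.pδ_pδ h x
end
end

section
/- Let Θ : G → PicS(R) be a unital partial representation with Θ_x ⊗_R Θ_{x⁻¹} ≅ R1_x, and fix Morita-context isomorphisms τ_x : Θ_x ⊗ Θ_{x⁻¹} → R1_x, written u_x u_{x⁻¹} := τ_x(u_x ⊗ u_{x⁻¹}). Write Σ_{(x)} ω_x ω_{x⁻¹} = 1_x. Then the map (~) : Aut_{R-R}(1_y Θ_x) → U(Z 1_x 1_y), σ ↦ σ̃ := Σ_{(x)} σ(1_y ω_x) ω_{x⁻¹}, is a group isomorphism, and moreover σ(1_y u_x) = σ̃ · u_x for all u_x ∈ Θ_x. -/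
noncomputable section

open MulOpposite

universe u v w

/-- A unital partial representation `Θ : G → PicS(R)` of a group `G` into the Picard
semigroup of partially invertible `R`-bimodules, presented by chosen representatives:
* `R`-bimodules `Θ x` with `Θ 1 ≅ R`;
* central idempotents `e x ∈ R` with `ε_x = Θ x ⊗ Θ x⁻¹ ≅ R·(e x)`, the isomorphism
  being given by a surjective Morita pairing `τ x : Θ x ⊗ Θ x⁻¹ → R·(e x)` (written
  `u·v`), which is `R`-bilinear, `R`-balanced and associative
  (`(u v) u' = u (v u')`), together with a decomposition `∑ ωᵢ ωᵢ' = e x`;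
* `Θ x` is a unital `R e x`-`R e x⁻¹`-bimodule;
* the partial representation identities, through the induced `R`-bimodule isomorphisms
  `Θ x · 1_y ≅ 1_{xy} · Θ x` (the maps `kap x y`, given as corner maps with inverse) and
  the centrality identity for `Θ x ⊗ Θ y ⊗ Θ (xy)⁻¹ ≅ R 1_x 1_{xy}`. -/
structure UPR (R : Type u) [Ring R] (G : Type v) [Group G] where
  Θ : G → Type w
  [instAdd : ∀ x, AddCommGroup (Θ x)]
  [instL : ∀ x, Module R (Θ x)]
  [instR : ∀ x, Module Rᵐᵒᵖ (Θ x)]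
  [instC : ∀ x, SMulCommClass R Rᵐᵒᵖ (Θ x)]
  e : G → R
  e_center : ∀ x, e x ∈ Subring.center R
  e_idem : ∀ x, IsIdempotentElem (e x)
  e_one : e 1 = 1
  τ : ∀ x : G, Θ x → Θ x⁻¹ → R
  τ_addl : ∀ (x : G) (u v : Θ x) (w : Θ x⁻¹), τ x (u + v) w = τ x u w + τ x v w
  τ_addr : ∀ (x : G) (u : Θ x) (v w : Θ x⁻¹), τ x u (v + w) = τ x u v + τ x u w
  τ_linl : ∀ (x : G) (r : R) (u : Θ x) (v : Θ x⁻¹), τ x (r • u) v = r * τ x u v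
  τ_linr : ∀ (x : G) (r : R) (u : Θ x) (v : Θ x⁻¹), τ x u (op r • v) = τ x u v * r
  τ_bal : ∀ (x : G) (r : R) (u : Θ x) (v : Θ x⁻¹), τ x (op r • u) v = τ x u (r • v)
  τ_mem : ∀ (x : G) (u : Θ x) (v : Θ x⁻¹), τ x u v * e x = τ x u v
  unital_l : ∀ (x : G) (u : Θ x), e x • u = u
  unital_r : ∀ (x : G) (u : Θ x), op (e x⁻¹) • u = u
  assoc₁ : ∀ (x : G) (u u' : Θ x) (v : Θ x⁻¹),
    τ x u v • u' = op (τ x⁻¹ v (cast (congrArg Θ (inv_inv x).symm) u')) • u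
  assoc₂ : ∀ (x : G) (v v' : Θ x⁻¹) (u : Θ x),
    τ x⁻¹ v (cast (congrArg Θ (inv_inv x).symm) u) • v' = op (τ x u v') • v
  dec : ∀ x : G, ∃ (n : ℕ) (ω : Fin n → Θ x × Θ x⁻¹),
    (∑ i, τ x (ω i).1 (ω i).2) = e x
  one_equiv : Θ 1 ≃+ R
  one_equiv_l : ∀ (r : R) (u : Θ 1), one_equiv (r • u) = r * one_equiv u
  one_equiv_r : ∀ (r : R) (u : Θ 1), one_equiv (op r • u) = one_equiv u * r
  triple : ∀ (x y : G) (r : R), r ∈ Subring.center R →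
    ∀ (ux : Θ x) (ux' : Θ x⁻¹) (uy : Θ y) (uy' : Θ y⁻¹)
      (uxy : Θ (x * y)) (uxy' : Θ (x * y)⁻¹),
      τ x (op (τ y uy uy') • ux) ux' * τ (x * y) (op r • uxy) uxy'
        = τ x (op (τ y (op r • uy) uy') • ux) ux' * τ (x * y) uxy uxy'
  kap : ∀ (x : G), G → Θ x → Θ x
  kap_add : ∀ (x y : G) (a b : Θ x), kap x y (a + b) = kap x y a + kap x y b
  kap_l : ∀ (x y : G) (r : R) (a : Θ x), kap x y (r • a) = r • kap x y a
  kap_r : ∀ (x y : G) (r : R) (a : Θ x), kap x y (op r • a) = op r • kap x y a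
  kap_im : ∀ (x y : G) (a : Θ x), e (x * y) • kap x y a = kap x y a
  kap_fac : ∀ (x y : G) (a : Θ x), kap x y (op (e y) • a) = kap x y a
  kap_bij : ∀ x y : G, ∃ k' : Θ x → Θ x,
    (∀ a b, k' (a + b) = k' a + k' b) ∧ (∀ (r : R) a, k' (r • a) = r • k' a) ∧
    (∀ (r : R) a, k' (op r • a) = op r • k' a) ∧
    (∀ a, op (e y) • k' a = k' a) ∧ (∀ a, k' (e (x * y) • a) = k' a) ∧
    (∀ a, k' (kap x y a) = op (e y) • a) ∧ (∀ a, kap x y (k' a) = e (x * y) • a)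

attribute [instance] UPR.instAdd UPR.instL UPR.instR UPR.instC

variable {R : Type u} [Ring R] {G : Type v} [Group G]

/-- An `R`-bimodule automorphism of the corner bimodule `1_y Θ x`, presented as a map
`σ : Θ x → Θ x` which is additive, `R`-bilinear, has image in `1_y Θ x`, factors through
the projection `u ↦ 1_y u`, and has an inverse of the same kind. -/
def CornerAuto (S : UPR R G) (x y : G) (σ : S.Θ x → S.Θ x) : Prop :=
  (∀ a b, σ (a + b) = σ a + σ b) ∧
  (∀ (r : R) a, σ (r • a) = r • σ a) ∧
  (∀ (r : R) a, σ (op r • a) = op r • σ a) ∧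
  (∀ a, S.e y • σ a = σ a) ∧
  (∀ a, σ (S.e y • a) = σ a) ∧
  (∃ σ' : S.Θ x → S.Θ x,
    (∀ a b, σ' (a + b) = σ' a + σ' b) ∧
    (∀ (r : R) a, σ' (r • a) = r • σ' a) ∧
    (∀ (r : R) a, σ' (op r • a) = op r • σ' a) ∧
    (∀ a, S.e y • σ' a = σ' a) ∧ (∀ a, σ' (S.e y • a) = σ' a) ∧
    (∀ a, σ' (σ a) = S.e y • a) ∧ (∀ a, σ (σ' a) = S.e y • a))

namespace UPR

variable (S : UPR R G)

lemma e_comm (x : G) (r : R) : r * S.e x = S.e x * r :=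
  Subring.mem_center_iff.mp (S.e_center x) r

lemma smul_e_comm (x y : G) (r : R) (u : S.Θ x) : r • S.e y • u = S.e y • r • u := by
  rw [smul_smul, smul_smul, S.e_comm]

variable {S} {x y : G} {n : ℕ} {ω : Fin n → S.Θ x × S.Θ x⁻¹}

/-- If a map acts on `1_y Θ x` as multiplication by `z`, then `σ̃ = z 1_x`. -/
lemma sum_pairing_eq_mul (hω : (∑ i, S.τ x (ω i).1 (ω i).2) = S.e x)
    {σ : S.Θ x → S.Θ x} {z : R} (h : ∀ u, σ (S.e y • u) = z • u) :
    ∑ i, S.τ x (σ (S.e y • (ω i).1)) (ω i).2 = z * S.e x := by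
  simp_rw [h, S.τ_linl, ← Finset.mul_sum, hω]

lemma mul_e_eq_of_smul_eq {a b : R} (h : ∀ u : S.Θ x, a • u = b • u) :
    a * S.e x = b * S.e x := by
  obtain ⟨n, ω, hω⟩ := S.dec x
  simp_rw [← hω, Finset.mul_sum, ← S.τ_linl, h]

end UPR

namespace CornerAuto

variable {S : UPR R G} {x y : G} {σ γ : S.Θ x → S.Θ x} {n : ℕ} {ω : Fin n → S.Θ x × S.Θ x⁻¹}

lemma apply_e_smul (hσ : CornerAuto S x y σ) (hω : (∑ i, S.τ x (ω i).1 (ω i).2) = S.e x)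
    (u : S.Θ x) :
    σ (S.e y • u) = (∑ i, S.τ x (σ (S.e y • (ω i).1)) (ω i).2) • u := by
  obtain ⟨hadd, -, hr, -⟩ := hσ
  let s : S.Θ x →+ S.Θ x := AddMonoidHom.mk' σ hadd
  have key : ∀ i, S.τ x (σ (S.e y • (ω i).1)) (ω i).2 • u
      = s (S.e y • S.τ x (ω i).1 (ω i).2 • u) := fun i => by
    rw [S.assoc₁, ← hr, ← smul_comm (S.e y) (op _), ← S.assoc₁]
    rfl
  rw [Finset.sum_smul, Finset.sum_congr rfl fun i _ => key i, ← map_sum, ← Finset.smul_sum,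
    ← Finset.sum_smul, hω, S.unital_l]
  rfl

lemma sum_pairing_mul_e (σ : S.Θ x → S.Θ x) :
    (∑ i, S.τ x (σ (S.e y • (ω i).1)) (ω i).2) * S.e x
      = ∑ i, S.τ x (σ (S.e y • (ω i).1)) (ω i).2 := by
  simp_rw [Finset.sum_mul, S.τ_mem]

lemma sum_pairing_mul_e_mul_e (hσ : CornerAuto S x y σ) :
    (∑ i, S.τ x (σ (S.e y • (ω i).1)) (ω i).2) * (S.e x * S.e y)
      = ∑ i, S.τ x (σ (S.e y • (ω i).1)) (ω i).2 := by
  obtain ⟨-, -, -, him, -⟩ := hσ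
  rw [← mul_assoc, sum_pairing_mul_e, S.e_comm]
  simp_rw [Finset.mul_sum, ← S.τ_linl, him]

lemma sum_pairing_mem_center (hσ : CornerAuto S x y σ)
    (hω : (∑ i, S.τ x (ω i).1 (ω i).2) = S.e x) :
    ∑ i, S.τ x (σ (S.e y • (ω i).1)) (ω i).2 ∈ Subring.center R := by
  have happ := hσ.apply_e_smul hω
  have he := sum_pairing_mul_e (ω := ω) (y := y) σ
  obtain ⟨-, hl, -⟩ := hσ
  generalize ∑ i, S.τ x (σ (S.e y • (ω i).1)) (ω i).2 = z at happ he ⊢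
  refine Subring.mem_center_iff.mpr fun r => ?_
  have h : ∀ u : S.Θ x, (r * z) • u = (z * r) • u := fun u => by
    rw [mul_smul, mul_smul, ← happ, ← happ, ← hl, S.smul_e_comm]
  have := UPR.mul_e_eq_of_smul_eq h
  rwa [mul_assoc, he, mul_assoc, S.e_comm, ← mul_assoc, he] at this

lemma sum_pairing_comp (hσ : CornerAuto S x y σ) (hγ : CornerAuto S x y γ)
    (hω : (∑ i, S.τ x (ω i).1 (ω i).2) = S.e x) :
    ∑ i, S.τ x ((σ ∘ γ) (S.e y • (ω i).1)) (ω i).2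
      = (∑ i, S.τ x (σ (S.e y • (ω i).1)) (ω i).2)
        * ∑ i, S.τ x (γ (S.e y • (ω i).1)) (ω i).2 := by
  rw [UPR.sum_pairing_eq_mul hω (σ := σ ∘ γ) fun u => ?_, mul_assoc, sum_pairing_mul_e]
  rw [Function.comp_apply, ← hγ.2.2.2.1, hσ.apply_e_smul hω, hγ.apply_e_smul hω, mul_smul]

lemma exists_inverse (hσ : CornerAuto S x y σ) :
    ∃ σ', CornerAuto S x y σ' ∧ ∀ a, σ (σ' a) = S.e y • a := by
  obtain ⟨h1, h2, h3, h4, h5, σ', g1, g2, g3, g4, g5, g6, g7⟩ := hσ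
  exact ⟨σ', ⟨g1, g2, g3, g4, g5, σ, h1, h2, h3, h4, h5, g7, g6⟩, g7⟩

lemma eq_smul (hσ : CornerAuto S x y σ) (hω : (∑ i, S.τ x (ω i).1 (ω i).2) = S.e x)
    (u : S.Θ x) : σ u = (∑ i, S.τ x (σ (S.e y • (ω i).1)) (ω i).2) • u := by
  rw [← hσ.apply_e_smul hω, hσ.2.2.2.2.1]

/-- Multiplication by a unit of `Z 1_x 1_y` is an automorphism of `1_y Θ x`. -/
lemma smul_of_center {z w : R} (hz : z ∈ Subring.center R) (hze : z * (S.e x * S.e y) = z)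
    (hw : w ∈ Subring.center R) (hwe : w * (S.e x * S.e y) = w)
    (hzw : z * w = S.e x * S.e y) : CornerAuto S x y (z • ·) := by
  have absorb : ∀ {c : R}, c * (S.e x * S.e y) = c → c * S.e y = c := fun {c} hc => by
    rw [← hc, mul_assoc, mul_assoc, (S.e_idem y).eq]
  have comm : ∀ {c : R}, c ∈ Subring.center R → ∀ (r : R) (a : S.Θ x),
      c • r • a = r • c • a := fun {c} hc r a => by
    rw [smul_smul, smul_smul, Subring.mem_center_iff.mp hc r]
  have act : ∀ a : S.Θ x, z • w • a = S.e y • a := fun a => by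
    rw [smul_smul, hzw, S.e_comm, mul_smul, S.unital_l]
  have img : ∀ {c : R}, c * (S.e x * S.e y) = c → ∀ a : S.Θ x, c • S.e y • a = c • a :=
    fun hc a => by rw [smul_smul, absorb hc]
  exact ⟨smul_add z, comm hz, fun r a => smul_comm z (op r) a,
    fun a => by rw [← S.smul_e_comm, img hze], img hze, (w • ·), smul_add w, comm hw,
    fun r a => smul_comm w (op r) a, fun a => by rw [← S.smul_e_comm, img hwe], img hwe,
    fun a => (comm hw z a).trans (act a), act⟩

end CornerAuto

/-- for a unital partial representation `Θ : G → PicS(R)` with Morita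
pairings `τ_x : Θ x ⊗ Θ x⁻¹ → R 1_x` (written multiplicatively) and a decomposition
`∑ᵢ ωᵢ ωᵢ' = 1_x`, the map `σ ↦ σ̃ := ∑ᵢ σ(1_y ωᵢ)·ωᵢ'` is a group isomorphism
`Aut_{R-R}(1_y Θ x) ≅ U(Z 1_x 1_y)` (where `Z` is the center of `R`), independent of the
chosen decomposition of `1_x`, and moreover `σ(1_y u) = σ̃ · u` for all `u ∈ Θ x`. -/
theorem statement14 (S : UPR R G) (x y : G)
    (n : ℕ) (ω : Fin n → S.Θ x × S.Θ x⁻¹)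
    (hω : (∑ i, S.τ x (ω i).1 (ω i).2) = S.e x) :
    ∀ tld : (S.Θ x → S.Θ x) → R,
      tld = (fun σ => ∑ i, S.τ x (σ (S.e y • (ω i).1)) ((ω i).2)) →
      -- independence of the decomposition of `1_x`
      (∀ σ, CornerAuto S x y σ →
        ∀ (m : ℕ) (ω' : Fin m → S.Θ x × S.Θ x⁻¹),
          (∑ j, S.τ x (ω' j).1 (ω' j).2) = S.e x →
          tld σ = ∑ j, S.τ x (σ (S.e y • (ω' j).1)) ((ω' j).2)) ∧
      -- `σ̃` lies in `U(Z 1_x 1_y)`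
      (∀ σ, CornerAuto S x y σ →
        tld σ ∈ Subring.center R ∧ tld σ * (S.e x * S.e y) = tld σ ∧
        ∃ w : R, w ∈ Subring.center R ∧ w * (S.e x * S.e y) = w ∧
          tld σ * w = S.e x * S.e y) ∧
      -- `σ(1_y u) = σ̃ u`
      (∀ σ, CornerAuto S x y σ → ∀ u : S.Θ x, σ (S.e y • u) = tld σ • u) ∧
      -- group homomorphism
      (∀ σ γ, CornerAuto S x y σ → CornerAuto S x y γ →
        tld (σ ∘ γ) = tld σ * tld γ) ∧
      -- injective
      (∀ σ γ, CornerAuto S x y σ → CornerAuto S x y γ → tld σ = tld γ → σ = γ) ∧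
      -- surjective onto `U(Z 1_x 1_y)`
      (∀ z : R, z ∈ Subring.center R → z * (S.e x * S.e y) = z →
        (∃ w : R, w ∈ Subring.center R ∧ w * (S.e x * S.e y) = w ∧
          z * w = S.e x * S.e y) →
        ∃ σ, CornerAuto S x y σ ∧ tld σ = z) := by
  rintro tld rfl
  refine ⟨fun σ hσ m ω' hω' => ?_, fun σ hσ => ⟨hσ.sum_pairing_mem_center hω,
    hσ.sum_pairing_mul_e_mul_e, ?_⟩, fun σ hσ => hσ.apply_e_smul hω,
    fun σ γ hσ hγ => hσ.sum_pairing_comp hγ hω, fun σ γ hσ hγ h => funext fun u => ?_, ?_⟩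
  · dsimp only
    rw [UPR.sum_pairing_eq_mul hω' (hσ.apply_e_smul hω), CornerAuto.sum_pairing_mul_e]
  · obtain ⟨σ', hσ', hinv⟩ := hσ.exists_inverse
    refine ⟨_, hσ'.sum_pairing_mem_center hω, hσ'.sum_pairing_mul_e_mul_e, ?_⟩
    dsimp only
    rw [← hσ.sum_pairing_comp hσ' hω, UPR.sum_pairing_eq_mul hω (z := S.e y) fun u => ?_,
      S.e_comm]
    rw [Function.comp_apply, hinv, smul_smul, (S.e_idem y).eq]
  · rw [hσ.eq_smul hω, hγ.eq_smul hω]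
    exact congrArg (· • u) h
  · rintro z hz hze ⟨w, hw, hwe, hzw⟩
    have hσ := CornerAuto.smul_of_center hz hze hw hwe hzw
    refine ⟨_, hσ, ?_⟩
    dsimp only
    rw [UPR.sum_pairing_eq_mul hω (σ := (z • ·)) (z := z) hσ.2.2.2.2.1, ← hze, mul_assoc,
      S.e_comm x (S.e x * S.e y), ← mul_assoc (S.e x), (S.e_idem x).eq]
end
end
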